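/- arXiv:2205.04380 — 2 statements merged into one kernel-verified Lean document; each statement's English description precedes it below -/
import Mathlib

section
/- Let n be an odd positive integer. Then the first Galois cohomology set H¹(PGL_n(ℂ), σ) is trivial: every element c ∈ PGL_n(ℂ) satisfying the cocycle condition c·σ(c) = 1 can be written as c = a·σ(a)⁻¹ for some a ∈ PGL_n(ℂ). -/
open Matrix

noncomputable section

/-- Entrywise complex conjugation as a ring automorphism of `n × n` complex matrices. -/
def conjMat (n : ℕ) : Matrix (Fin n) (Fin n) ℂ ≃+* Matrix (Fin n) (Fin n) ℂ :=
  (starRingAut : ℂ ≃+* ℂ).mapMatrix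

/-- Entrywise complex conjugation `g ↦ ḡ` as an automorphism of `GL n ℂ`. -/
def conjGL (n : ℕ) : GL (Fin n) ℂ ≃* GL (Fin n) ℂ :=
  Units.mapEquiv (conjMat n).toMulEquiv

/-- The projective general linear group `PGL n ℂ = GL n ℂ / center`. -/
abbrev PGL (n : ℕ) := GL (Fin n) ℂ ⧸ Subgroup.center (GL (Fin n) ℂ)

lemma center_le_comap {G : Type*} [Group G] (e : G ≃* G) :
    Subgroup.center G ≤ (Subgroup.center G).comap e.toMonoidHom := by
  intro x hx
  rw [Subgroup.mem_comap, Subgroup.mem_center_iff]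
  intro y
  rw [Subgroup.mem_center_iff] at hx
  have := congrArg e (hx (e.symm y))
  simpa [_root_.map_mul] using this

/-- The involution `σ` of `PGL n ℂ` induced by entrywise complex conjugation. -/
def conjPGL (n : ℕ) : PGL n →* PGL n :=
  QuotientGroup.map _ _ (conjGL n).toMonoidHom (center_le_comap (conjGL n))

/-- The canonical projection `π : GL n ℂ → PGL n ℂ`. -/
def PGLmk (n : ℕ) : GL (Fin n) ℂ →* PGL n := QuotientGroup.mk' _

lemma conjMat_smul {n : ℕ} (z : ℂ) (A : Matrix (Fin n) (Fin n) ℂ) :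
    conjMat n (z • A) = star z • conjMat n A := by
  ext i j
  simp [conjMat]

lemma conjMat_conjMat {n : ℕ} (A : Matrix (Fin n) (Fin n) ℂ) :
    conjMat n (conjMat n A) = A := by
  ext i j
  simp [conjMat]

lemma det_conjMat {n : ℕ} (A : Matrix (Fin n) (Fin n) ℂ) :
    (conjMat n A).det = star A.det :=
  ((starRingAut : ℂ ≃+* ℂ).map_det A).symm

lemma trace_conjMat {n : ℕ} (A : Matrix (Fin n) (Fin n) ℂ) :
    (conjMat n A).trace = star A.trace := by
  simp [conjMat, Matrix.trace]

/-- If `A * Ā` is the scalar `r` for an invertible matrix `A` of odd size, then `r` is a positive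
real number, so it is the square of a nonzero real number. -/
lemma exists_real_sq_of_mul_conjMat_eq_smul_one {n : ℕ} (hodd : Odd n)
    {A : Matrix (Fin n) (Fin n) ℂ} (hdet : A.det ≠ 0) {r : ℂ}
    (h : A * conjMat n A = r • (1 : Matrix (Fin n) (Fin n) ℂ)) :
    ∃ s : ℝ, s ≠ 0 ∧ r = (s : ℂ) * s := by
  have hn : (n : ℂ) ≠ 0 := by exact_mod_cast hodd.pos.ne'
  have htr : star (A * conjMat n A).trace = (A * conjMat n A).trace := by
    rw [← trace_conjMat, map_mul, conjMat_conjMat, Matrix.trace_mul_comm]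
  have hreal : star r = r := by
    rw [h] at htr
    simpa [hn] using htr
  obtain ⟨x, rfl⟩ := Complex.conj_eq_iff_real.mp hreal
  have hpow : x ^ n = Complex.normSq A.det := by
    have hd := congrArg Matrix.det h
    rw [Matrix.det_mul, det_conjMat, Matrix.det_smul, Matrix.det_one, mul_one,
      Fintype.card_fin] at hd
    have : ((x ^ n : ℝ) : ℂ) = (Complex.normSq A.det : ℂ) := by
      rw [← Complex.mul_conj, Complex.ofReal_pow]
      exact hd.symm
    exact_mod_cast this
  have hx : 0 < x := hodd.pow_pos_iff.mp (hpow ▸ Complex.normSq_pos.mpr hdet)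
  refine ⟨√x, (Real.sqrt_pos.mpr hx).ne', ?_⟩
  exact_mod_cast (Real.mul_self_sqrt hx.le).symm

open Polynomial in
/-- Some combination `s z + z̄ A` with `z` of real part one is invertible. -/
lemma exists_det_smul_one_add_star_smul_ne_zero {n : ℕ} (A : Matrix (Fin n) (Fin n) ℂ) {s : ℂ}
    (hs : s ≠ 0) :
    ∃ z : ℂ, ((s * z) • (1 : Matrix (Fin n) (Fin n) ℂ) + star z • A).det ≠ 0 := by
  set p : ℂ[X] := ((C s * (1 + C Complex.I * X)) • (1 : Matrix (Fin n) (Fin n) ℂ[X]) +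
    (1 - C Complex.I * X) • A.map C).det with hp
  have heval (t : ℂ) : p.eval t = ((s * (1 + Complex.I * t)) • (1 : Matrix (Fin n) (Fin n) ℂ) +
      (1 - Complex.I * t) • A).det := by
    rw [hp, ← coe_evalRingHom, RingHom.map_det]
    congr 1
    ext i j
    simp [Matrix.one_apply, apply_ite]
  have hp0 : p ≠ 0 := by
    intro h0
    have h := heval (-Complex.I)
    have h2 : s * (1 + Complex.I * -Complex.I) = s * 2 := by
      linear_combination -s * Complex.I_mul_I
    have h3 : (1 : ℂ) - Complex.I * -Complex.I = 0 := by
      linear_combination Complex.I_mul_I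
    rw [h0, h2, h3] at h
    have h4 : (s * 2) ^ n ≠ 0 := pow_ne_zero n (mul_ne_zero hs two_ne_zero)
    exact h4 (by simpa using h.symm)
  by_contra! hall
  refine hp0 (p.eq_zero_of_infinite_isRoot ?_)
  refine (Set.infinite_range_of_injective Complex.ofReal_injective).mono ?_
  rintro _ ⟨t, rfl⟩
  have h := hall (1 + Complex.I * t)
  rw [Set.mem_ofPred_eq, IsRoot, heval, ← h]
  simp [sub_eq_add_neg]

/-- Hilbert 90 for complex conjugation: if `A * Ā = s²` with `s` real and nonzero, then
`A * B̄ = s B` for some invertible `B`. -/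
lemma exists_mul_conjMat_eq_smul {n : ℕ} {A : Matrix (Fin n) (Fin n) ℂ} {s : ℝ} (hs : s ≠ 0)
    (h : A * conjMat n A = ((s : ℂ) * s) • (1 : Matrix (Fin n) (Fin n) ℂ)) :
    ∃ B : Matrix (Fin n) (Fin n) ℂ, B.det ≠ 0 ∧ A * conjMat n B = (s : ℂ) • B := by
  obtain ⟨z, hz⟩ := exists_det_smul_one_add_star_smul_ne_zero A (Complex.ofReal_ne_zero.mpr hs)
  refine ⟨_, hz, ?_⟩
  rw [map_add, conjMat_smul, conjMat_smul, map_one, mul_add, Matrix.mul_smul, Matrix.mul_smul, h]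
  ext i j
  simp
  ring

lemma exists_val_eq_smul_one_of_mem_center {n : ℕ} {g : GL (Fin n) ℂ}
    (hg : g ∈ Subgroup.center (GL (Fin n) ℂ)) :
    ∃ r : ℂ, (g : Matrix (Fin n) (Fin n) ℂ) = r • 1 := by
  obtain ⟨r, hr⟩ := Matrix.GeneralLinearGroup.mem_center_iff_val_mem_range_scalar.mp hg
  exact ⟨r, by rw [← hr, Matrix.scalar_apply, Matrix.smul_one_eq_diagonal]⟩

lemma PGLmk_eq_of_val_eq_smul {n : ℕ} {g h : GL (Fin n) ℂ} {s : ℂ} (hs : s ≠ 0)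
    (hgh : (g : Matrix (Fin n) (Fin n) ℂ) = s • (h : Matrix (Fin n) (Fin n) ℂ)) :
    PGLmk n g = PGLmk n h := by
  set u := Matrix.GeneralLinearGroup.scalar (Fin n) (Units.mk0 s hs)
  have hu : PGLmk n u = 1 := by
    refine (QuotientGroup.eq_one_iff u).mpr ?_
    rw [Matrix.GeneralLinearGroup.center_eq_range_scalar]
    exact ⟨_, rfl⟩
  have : g = u * h := by
    ext i j
    simp [u, hgh]
  rw [this, map_mul, hu, one_mul]

/-- for odd positive `n`, the Galois cohomology set `H¹(PGL_n(ℂ), σ)` is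
trivial: every `1`-cocycle `c` (i.e. `c · σ(c) = 1`) is of the form `c = a · σ(a)⁻¹`. -/
theorem H1_PGL_odd_trivial (n : ℕ) (hpos : 0 < n) (hodd : Odd n)
    (c : PGL n) (hc : c * conjPGL n c = 1) :
    ∃ a : PGL n, c = a * (conjPGL n a)⁻¹ := by
  obtain ⟨g, rfl⟩ := QuotientGroup.mk'_surjective _ c
  have hcenter : g * conjGL n g ∈ Subgroup.center (GL (Fin n) ℂ) :=
    (QuotientGroup.eq_one_iff _).mp hc
  obtain ⟨r, hr⟩ := exists_val_eq_smul_one_of_mem_center hcenter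
  have hdet : (g : Matrix (Fin n) (Fin n) ℂ).det ≠ 0 :=
    (Matrix.GeneralLinearGroup.det g).ne_zero
  obtain ⟨s, hs, rfl⟩ := exists_real_sq_of_mul_conjMat_eq_smul_one hodd hdet hr
  obtain ⟨B, hB, hAB⟩ := exists_mul_conjMat_eq_smul hs hr
  let b : GL (Fin n) ℂ := Matrix.GeneralLinearGroup.mkOfDetNeZero B hB
  refine ⟨PGLmk n b, eq_mul_inv_of_mul_eq ?_⟩
  exact PGLmk_eq_of_val_eq_smul (g := g * conjGL n b) (Complex.ofReal_ne_zero.mpr hs) hAB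

end
end

section
/- Let n' be a positive integer, n = 2n', J = [[0,1],[-1,0]], a_J = diag(J,…,J) ∈ GL_n(ℂ) the block-diagonal matrix with n' blocks J, and let k be an odd integer with 0 ≤ k ≤ n. Then there is no k-dimensional ℂ-linear subspace W ⊆ ℂⁿ such that a_J · W̄ = W, where W̄ = { w̄ | w ∈ W } is the image of W under entrywise complex conjugation and a_J · W̄ denotes the image of W̄ under multiplication by the matrix a_J. -/
open Matrix

noncomputable section

/-- The matrix `J = [[0,1],[-1,0]]`. -/
def Jmat : Matrix (Fin 2) (Fin 2) ℂ := !![0, 1; -1, 0]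

/-- The interleaving bijection `Fin 2 × Fin n' ≃ Fin (2 * n')`, `(p, b) ↦ p + 2 * b`. -/
def interleave (n' : ℕ) : Fin 2 × Fin n' ≃ Fin (2 * n') :=
  (Equiv.prodComm _ _).trans (finProdFinEquiv.trans (finCongr (Nat.mul_comm n' 2)))

/-- The block-diagonal matrix `a_J = diag(J, …, J)` with `n'` diagonal blocks `J`:
its `(p + 2b, q + 2c)` entry is `J p q` if `b = c` and `0` otherwise. -/
def aJ (n' : ℕ) : Matrix (Fin (2 * n')) (Fin (2 * n')) ℂ :=
  (Matrix.blockDiagonal fun _ : Fin n' => Jmat).submatrix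
    (interleave n').symm (interleave n').symm

/-- Entrywise complex conjugation on `ℂⁿ`, as a conjugate-semilinear map. -/
def conjVec (n : ℕ) : (Fin n → ℂ) →ₛₗ[starRingEnd ℂ] (Fin n → ℂ) where
  toFun v := fun i => starRingEnd ℂ (v i)
  map_add' u v := by funext i; simp
  map_smul' c v := by funext i; simp

/-- A finite-dimensional complex vector space carrying a conjugate-linear map that squares to `-1`
(a quaternionic structure) has even dimension. -/
theorem even_finrank_of_conjLinear_sq_eq_neg {V : Type*} [AddCommGroup V] [Module ℂ V]
    [FiniteDimensional ℂ V] (f : V →ₛₗ[starRingEnd ℂ] V) (hf : ∀ v, f (f v) = -v) :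
    Even (Module.finrank ℂ V) := by
  let b := Module.finBasis ℂ V
  let M : Matrix (Fin (Module.finrank ℂ V)) (Fin (Module.finrank ℂ V)) ℂ :=
    Matrix.of fun i j => b.repr (f (b j)) i
  have hM : M * M.map (starRingEnd ℂ) = -1 := by
    ext i j
    have h : b.repr (f (f (b j))) i = -(b.repr (b j) i) := by simp [hf]
    rw [← b.sum_repr (f (b j))] at h
    simp only [map_sum, LinearMap.map_smulₛₗ, map_smul, Finsupp.coe_finsetSum, Finset.sum_apply,
      Finsupp.smul_apply, smul_eq_mul, Module.Basis.repr_self] at h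
    simpa [Matrix.mul_apply, M, mul_comm, Matrix.one_apply, Finsupp.single_apply, eq_comm] using h
  have hdet : ((Complex.normSq M.det : ℝ) : ℂ) = (-1) ^ Module.finrank ℂ V := by
    have h := congrArg Matrix.det hM
    rwa [Matrix.det_mul, ← RingHom.mapMatrix_apply, ← RingHom.map_det, Complex.mul_conj,
      Matrix.det_neg, Matrix.det_one, mul_one, Fintype.card_fin] at h
  by_contra h
  rw [Nat.not_even_iff_odd] at h
  rw [h.neg_one_pow] at hdet
  have hneg : Complex.normSq M.det = -1 := by exact_mod_cast hdet
  linarith [Complex.normSq_nonneg M.det]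

theorem Jmat_mul_Jmat : Jmat * Jmat = -1 := by
  ext i j
  fin_cases i <;> fin_cases j <;> simp [Jmat]

theorem Jmat_map_conj : Jmat.map (starRingEnd ℂ) = Jmat := by
  ext i j
  fin_cases i <;> fin_cases j <;> simp [Jmat]

theorem aJ_mul_aJ (n' : ℕ) : aJ n' * aJ n' = -1 := by
  have h : (Matrix.blockDiagonal fun _ : Fin n' => (-1 : Matrix (Fin 2) (Fin 2) ℂ)) = -1 := by
    rw [← Matrix.blockDiagonal_one, ← Matrix.blockDiagonal_neg]
    rfl
  rw [aJ, Matrix.submatrix_mul_equiv, ← Matrix.blockDiagonal_mul]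
  simp only [Jmat_mul_Jmat, h, Matrix.submatrix_neg, Pi.neg_apply, Matrix.submatrix_one_equiv]

theorem aJ_map_conj (n' : ℕ) : (aJ n').map (starRingEnd ℂ) = aJ n' := by
  rw [aJ, ← Matrix.submatrix_map, Matrix.blockDiagonal_map _ _ (map_zero _)]
  simp only [Jmat_map_conj]

theorem conjVec_mulVec {n : ℕ} (A : Matrix (Fin n) (Fin n) ℂ) (v : Fin n → ℂ) :
    conjVec n (A *ᵥ v) = A.map (starRingEnd ℂ) *ᵥ conjVec n v :=
  funext fun i => RingHom.map_mulVec (starRingEnd ℂ) A v i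

theorem conjVec_conjVec {n : ℕ} (v : Fin n → ℂ) : conjVec n (conjVec n v) = v :=
  funext fun i => Complex.conj_conj (v i)

/-- for `n = 2n'` and odd `k ≤ n`, there is no `k`-dimensional complex
subspace `W ⊆ ℂⁿ` with `a_J · W̄ = W`. -/
theorem no_odd_dimensional_invariant_subspace (n' : ℕ) (hn' : 0 < n') (k : ℕ)
    (hk : Odd k) (hkle : k ≤ 2 * n') :
    ¬ ∃ W : Submodule ℂ (Fin (2 * n') → ℂ),
      Module.finrank ℂ W = k ∧
      Submodule.map (Matrix.mulVecLin (aJ n')) (Submodule.map (conjVec (2 * n')) W) = W := by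
  rintro ⟨W, hW, hinv⟩
  let f := (Matrix.mulVecLin (aJ n')).comp (conjVec (2 * n'))
  have hf : ∀ v, f (f v) = -v := fun v => by
    simp [f, conjVec_mulVec, conjVec_conjVec, aJ_map_conj, aJ_mul_aJ, Matrix.neg_mulVec]
  have hfW : ∀ v ∈ W, f v ∈ W := fun v hv => by
    rw [← hinv]
    exact Submodule.mem_map_of_mem (Submodule.mem_map_of_mem hv)
  have heven := even_finrank_of_conjLinear_sq_eq_neg (f.restrict hfW)
    fun v => Subtype.ext (hf v)
  rw [hW] at heven
  exact Nat.not_even_iff_odd.mpr hk heven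

end
end
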